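/- Fix α ∈ (0,1]. There is a constant C (one may take C = 6) such that for every f : [0,1] → ℝ with f(0)=f(1)=0 and ‖f‖_{C^α₀} := sup_{x≠y}|f(x)−f(y)|/|x−y|^α < ∞, and for all t > 0 and x, x' ∈ [0,1]: |(𝒢_t f)(x) − (𝒢_t f)(x')| ≤ C·‖f‖_{C^α₀}·|x−x'|^α, where (𝒢_t f)(x) = ∫₀¹ G_t(x,y)f(y)dy. -/

import Mathlib

open Real MeasureTheory intervalIntegral

/-- The Dirichlet heat kernel for `∂ₜu = (1/2)u''` on `[0,1]`. -/
noncomputable def G (t x y : ℝ) : ℝ :=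
  2 * ∑' n : ℕ, Real.sin (((n : ℝ) + 1) * Real.pi * x) *
    Real.sin (((n : ℝ) + 1) * Real.pi * y) *
    Real.exp (-((n : ℝ) + 1) ^ 2 * Real.pi ^ 2 * t / 2)

noncomputable def hkC (t : ℝ) (n : ℕ) : ℝ :=
  Real.exp (-((n : ℝ) + 1) ^ 2 * Real.pi ^ 2 * t / 2)

noncomputable def hkP (t u : ℝ) : ℝ :=
  1 / 2 + ∑' n : ℕ, Real.cos (((n : ℝ) + 1) * Real.pi * u) * hkC t n

lemma hkHasSum (t u : ℝ) (ht : 0 < t) :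
    HasSum (fun n : ℕ => Real.cos (((n : ℝ) + 1) * Real.pi * u) * hkC t n)
      ((HurwitzZeta.cosKernel ((u / 2 : ℝ) : UnitAddCircle) (π * t / 2) - 1) / 2) := by
  have h := HurwitzZeta.hasSum_nat_cosKernel₀ (u / 2) (t := π * t / 2) (by positivity)
  have h2 := h.div_const 2
  have e : (fun n : ℕ => Real.cos (((n : ℝ) + 1) * Real.pi * u) * hkC t n) =
      fun n : ℕ => 2 * Real.cos (2 * π * (u / 2) * (n + 1)) *
        rexp (-π * (n + 1) ^ 2 * (π * t / 2)) / 2 := by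
    funext n
    have e1 : ((n : ℝ) + 1) * Real.pi * u = 2 * π * (u / 2) * (n + 1) := by ring
    have e2 : -((n : ℝ) + 1) ^ 2 * Real.pi ^ 2 * t / 2 = -π * (n + 1) ^ 2 * (π * t / 2) := by
      ring
    rw [hkC, e1, e2]
    ring
  rw [e]
  exact h2

lemma hkC_nonneg (t : ℝ) (n : ℕ) : 0 ≤ hkC t n := (Real.exp_pos _).le

lemma hkC_summable (t : ℝ) (ht : 0 < t) : Summable (hkC t) := by
  simpa using (hkHasSum t 0 ht).summable

lemma hkP_nonneg (t u : ℝ) (ht : 0 < t) : 0 ≤ hkP t u := by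
  have h1 : hkP t u = HurwitzZeta.cosKernel ((u / 2 : ℝ) : UnitAddCircle) (π * t / 2) / 2 := by
    rw [hkP, (hkHasSum t u ht).tsum_eq]; ring
  have hs : 0 < π * t / 2 := by positivity
  have h2 := HurwitzZeta.evenKernel_functional_equation ((u / 2 : ℝ) : UnitAddCircle)
    (1 / (π * t / 2))
  rw [one_div_one_div] at h2
  have h3 : 0 ≤ HurwitzZeta.evenKernel ((u / 2 : ℝ) : UnitAddCircle) (1 / (π * t / 2)) :=
    (HurwitzZeta.hasSum_int_evenKernel (u / 2) (by positivity)).nonneg (fun n => (Real.exp_pos _).le)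
  rw [h2] at h3
  have h4 : 0 < 1 / (1 / (π * t / 2)) ^ (1 / 2 : ℝ) := by positivity
  have := nonneg_of_mul_nonneg_right h3 h4
  rw [h1]; linarith

lemma hk_term_bound (t : ℝ) (n : ℕ) (u : ℝ) :
    ‖Real.cos (((n : ℝ) + 1) * Real.pi * u) * hkC t n‖ ≤ hkC t n := by
  rw [norm_mul, Real.norm_eq_abs, Real.norm_eq_abs, abs_of_nonneg (hkC_nonneg t n)]
  exact mul_le_of_le_one_left (hkC_nonneg t n) (Real.abs_cos_le_one _)

lemma hkP_continuous (t : ℝ) (ht : 0 < t) : Continuous (hkP t) := by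
  unfold hkP
  refine continuous_const.add (continuous_tsum (u := hkC t) ?_ (hkC_summable t ht) ?_)
  · intro n; fun_prop
  · intro n u; exact hk_term_bound t n u

lemma hkP_periodic (t : ℝ) : Function.Periodic (hkP t) 2 := by
  intro u
  unfold hkP
  congr 2
  funext n
  have : ((n : ℝ) + 1) * Real.pi * (u + 2) = ((n : ℝ) + 1) * Real.pi * u + ((n + 1 : ℕ) : ℝ) * (2 * π) := by
    push_cast; ring
  rw [this, Real.cos_add_nat_mul_two_pi]

lemma hkP_integral (t : ℝ) (ht : 0 < t) : ∫ u in (-1 : ℝ)..1, hkP t u = 1 := by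
  have hs : HasSum (fun n : ℕ => ∫ u in (-1 : ℝ)..1, Real.cos (((n : ℝ) + 1) * Real.pi * u) * hkC t n)
      (∫ u in (-1 : ℝ)..1, ∑' n : ℕ, Real.cos (((n : ℝ) + 1) * Real.pi * u) * hkC t n) := by
    apply intervalIntegral.hasSum_integral_of_dominated_convergence (fun n _ => hkC t n)
    · intro n
      exact Continuous.aestronglyMeasurable (by fun_prop)
    · intro n; filter_upwards with u _ using hk_term_bound t n u
    · filter_upwards with u _ using hkC_summable t ht
    · exact intervalIntegrable_const
    · filter_upwards with u _ using (hkHasSum t u ht).summable.hasSum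
  have hz : ∀ n : ℕ, ∫ u in (-1 : ℝ)..1, Real.cos (((n : ℝ) + 1) * Real.pi * u) * hkC t n = 0 := by
    intro n
    rw [intervalIntegral.integral_mul_const]
    have hne : ((n : ℝ) + 1) * Real.pi ≠ 0 := by positivity
    rw [intervalIntegral.integral_comp_mul_left (fun v => Real.cos v) hne, integral_cos]
    have h1 : Real.sin (((n : ℝ) + 1) * Real.pi * 1) = 0 := by
      have := Real.sin_nat_mul_pi (n + 1)
      push_cast at this
      simpa using this
    have h2 : Real.sin (((n : ℝ) + 1) * Real.pi * (-1)) = 0 := by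
      rw [mul_neg, Real.sin_neg, h1, neg_zero]
    rw [h1, h2]; simp
  simp only [hz] at hs
  have h0 := hs.unique hasSum_zero
  unfold hkP
  rw [intervalIntegral.integral_add intervalIntegrable_const, h0]
  · norm_num
  · apply Continuous.intervalIntegrable
    refine continuous_tsum (u := hkC t) ?_ (hkC_summable t ht) ?_
    · intro n; fun_prop
    · intro n u; exact hk_term_bound t n u

lemma G_eq (t x y : ℝ) (ht : 0 < t) : G t x y = hkP t (x - y) - hkP t (x + y) := by
  unfold G hkP
  have h := (hkHasSum t (x - y) ht).summable.tsum_sub (hkHasSum t (x + y) ht).summable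
  rw [add_sub_add_left_eq_sub, ← h, ← tsum_mul_left]
  congr 1
  funext n
  have e1 : ((n : ℝ) + 1) * Real.pi * (x - y) = ((n : ℝ) + 1) * π * x - ((n : ℝ) + 1) * π * y := by ring
  have e2 : ((n : ℝ) + 1) * Real.pi * (x + y) = ((n : ℝ) + 1) * π * x + ((n : ℝ) + 1) * π * y := by ring
  rw [e1, e2, Real.cos_sub, Real.cos_add, hkC]
  ring

/-- odd 2-periodic extension -/
noncomputable def hkF (f : ℝ → ℝ) (y : ℝ) : ℝ :=
  if Even ⌊y⌋ then f (Int.fract y) else - f (1 - Int.fract y)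

lemma hkF_periodic (f : ℝ → ℝ) : Function.Periodic (hkF f) 2 := by
  intro y
  have h1 : ⌊y + 2⌋ = ⌊y⌋ + 2 := by exact_mod_cast Int.floor_add_ofNat y 2
  have h2 : Int.fract (y + 2) = Int.fract y := by exact_mod_cast Int.fract_add_ofNat y 2
  unfold hkF
  rw [h1, h2]
  simp [Int.even_add]

/-- value on the closed unit interval starting at n -/
lemma hkF_on (f : ℝ → ℝ) (h0 : f 0 = 0) (h1 : f 1 = 0) (n : ℤ) (y : ℝ)
    (hy : y ∈ Set.Icc (n : ℝ) (n + 1)) :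
    hkF f y = if Even n then f (y - n) else - f (1 - (y - n)) := by
  rcases hy.2.lt_or_eq with h | h
  · have : ⌊y⌋ = n := Int.floor_eq_iff.2 ⟨hy.1, h⟩
    unfold hkF Int.fract
    rw [this]
  · have e : ⌊y⌋ = n + 1 := by rw [h]; simp
    have e2 : Int.fract y = 0 := by rw [h]; simp
    have e3 : y - n = 1 := by linarith
    unfold hkF
    rw [e, e2, e3]
    simp [h0, h1]

lemma hkF_int (f : ℝ → ℝ) (h0 : f 0 = 0) (h1 : f 1 = 0) (n : ℤ) : hkF f n = 0 := by
  rw [hkF_on f h0 h1 n n ⟨le_rfl, by linarith⟩]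
  simp [h0, h1]

lemma hkF_loc (f : ℝ → ℝ) (h0 : f 0 = 0) (h1 : f 1 = 0) (M α : ℝ)
    (hf : ∀ x ∈ Set.Icc (0 : ℝ) 1, ∀ y ∈ Set.Icc (0 : ℝ) 1, |f x - f y| ≤ M * |x - y| ^ α)
    (n : ℤ) (x y : ℝ) (hx : x ∈ Set.Icc (n : ℝ) (n + 1)) (hy : y ∈ Set.Icc (n : ℝ) (n + 1)) :
    |hkF f x - hkF f y| ≤ M * |x - y| ^ α := by
  rw [hkF_on f h0 h1 n x hx, hkF_on f h0 h1 n y hy]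
  obtain ⟨a, b⟩ := hx
  obtain ⟨c, d⟩ := hy
  split_ifs with he
  · have := hf (x - n) ⟨by linarith, by linarith⟩ (y - n) ⟨by linarith, by linarith⟩
    simpa using this
  · have := hf (1 - (y - n)) ⟨by linarith, by linarith⟩ (1 - (x - n)) ⟨by linarith, by linarith⟩
    have e1 : 1 - (y - n) - (1 - (x - n)) = x - y := by ring
    have e2 : - f (1 - (x - n)) - - f (1 - (y - n)) = f (1 - (y - n)) - f (1 - (x - n)) := by ring
    rw [e1] at this
    rw [e2]; exact this

lemma hkF_holder (f : ℝ → ℝ) (h0 : f 0 = 0) (h1 : f 1 = 0) (M α : ℝ) (hα : 0 < α) (hM : 0 ≤ M)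
    (hf : ∀ x ∈ Set.Icc (0 : ℝ) 1, ∀ y ∈ Set.Icc (0 : ℝ) 1, |f x - f y| ≤ M * |x - y| ^ α)
    (x y : ℝ) : |hkF f x - hkF f y| ≤ 2 * M * |x - y| ^ α := by
  wlog hxy : x ≤ y generalizing x y
  · rw [abs_sub_comm, abs_sub_comm x y]
    exact this y x (le_of_not_ge hxy)
  have hp : 0 ≤ M * |x - y| ^ α := by positivity
  have hfx := Int.floor_le x
  have hfx' := (Int.lt_floor_add_one x).le
  have hfy := Int.floor_le y
  have hfy' := (Int.lt_floor_add_one y).le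
  rcases (Int.floor_le_floor hxy).lt_or_eq with h | h
  · have hle : (⌊x⌋ : ℝ) + 1 ≤ ⌊y⌋ := by exact_mod_cast h
    have a1 := hkF_loc f h0 h1 M α hf ⌊x⌋ x (⌊x⌋ + 1) ⟨hfx, hfx'⟩ ⟨by linarith, le_rfl⟩
    have a2 := hkF_loc f h0 h1 M α hf ⌊y⌋ ⌊y⌋ y ⟨le_rfl, by linarith⟩ ⟨hfy, hfy'⟩
    have z1 : hkF f (⌊x⌋ + 1) = 0 := by exact_mod_cast hkF_int f h0 h1 (⌊x⌋ + 1)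
    rw [z1] at a1
    rw [hkF_int f h0 h1] at a2
    have b1 : |x - (⌊x⌋ + 1)| ^ α ≤ |x - y| ^ α := by
      apply Real.rpow_le_rpow (abs_nonneg _) _ hα.le
      rw [abs_of_nonpos (by linarith), abs_of_nonpos (by linarith)]; linarith
    have b2 : |⌊y⌋ - y| ^ α ≤ |x - y| ^ α := by
      apply Real.rpow_le_rpow (abs_nonneg _) _ hα.le
      rw [abs_of_nonpos (by linarith), abs_of_nonpos (by linarith)]; linarith
    have c1 := mul_le_mul_of_nonneg_left b1 hM
    have c2 := mul_le_mul_of_nonneg_left b2 hM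
    have := abs_add_le (hkF f x - 0) (0 - hkF f y)
    have e : hkF f x - 0 + (0 - hkF f y) = hkF f x - hkF f y := by ring
    rw [e] at this
    linarith
  · have := hkF_loc f h0 h1 M α hf ⌊x⌋ x y ⟨hfx, hfx'⟩ ⟨by rw [h]; exact hfy, by rw [h]; exact hfy'⟩
    linarith

lemma hkF_continuous (f : ℝ → ℝ) (h0 : f 0 = 0) (h1 : f 1 = 0) (M α : ℝ) (hα : 0 < α) (hM : 0 ≤ M)
    (hf : ∀ x ∈ Set.Icc (0 : ℝ) 1, ∀ y ∈ Set.Icc (0 : ℝ) 1, |f x - f y| ≤ M * |x - y| ^ α) :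
    Continuous (hkF f) := by
  rw [continuous_iff_continuousAt]
  intro y
  rw [ContinuousAt, tendsto_iff_dist_tendsto_zero]
  have hlim : Filter.Tendsto (fun x : ℝ => 2 * M * |x - y| ^ α) (nhds y) (nhds 0) := by
    have hc : Continuous (fun x : ℝ => 2 * M * |x - y| ^ α) := by
      refine continuous_const.mul (Continuous.rpow_const (by fun_prop) (fun _ => Or.inr hα.le))
    have := hc.tendsto y
    simpa [Real.zero_rpow hα.ne'] using this
  refine squeeze_zero (fun _ => dist_nonneg) (fun x => ?_) hlim
  rw [Real.dist_eq]
  exact hkF_holder f h0 h1 M α hα hM hf x y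

lemma hk_repr (f : ℝ → ℝ) (h0 : f 0 = 0) (h1 : f 1 = 0) (hF : Continuous (hkF f)) (t x : ℝ)
    (ht : 0 < t) :
    ∫ y in (0 : ℝ)..1, G t x y * f y = ∫ z in (-1 : ℝ)..1, hkP t z * hkF f (x - z) := by
  have hP := hkP_continuous t ht
  have s1 : ∫ y in (0 : ℝ)..1, G t x y * f y
      = ∫ y in (0 : ℝ)..1, (hkP t (x - y) * hkF f y + hkP t (x - -y) * hkF f (-y)) := by
    apply intervalIntegral.integral_congr
    intro y hy
    rw [Set.uIcc_of_le zero_le_one] at hy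
    have e1 : hkF f y = f y := by
      rw [hkF_on f h0 h1 0 y (by simpa using hy)]; simp
    have e2 : hkF f (-y) = - f y := by
      rw [hkF_on f h0 h1 (-1) (-y) (by constructor <;> push_cast <;> linarith [hy.1, hy.2])]
      simp
    simp only [e1, e2, G_eq t x y ht, sub_neg_eq_add]
    ring
  have c1 : Continuous (fun y => hkP t (x - y) * hkF f y) := by fun_prop
  have s2 : ∫ y in (0 : ℝ)..1, hkP t (x - -y) * hkF f (-y)
      = ∫ y in (-1 : ℝ)..0, hkP t (x - y) * hkF f y := by
    rw [intervalIntegral.integral_comp_neg (fun y => hkP t (x - y) * hkF f y)]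
    simp
  rw [s1, intervalIntegral.integral_add (c1.intervalIntegrable _ _)
    (Continuous.intervalIntegrable (by fun_prop) _ _), s2, add_comm,
    intervalIntegral.integral_add_adjacent_intervals (c1.intervalIntegrable _ _)
    (c1.intervalIntegrable _ _)]
  have s3 := intervalIntegral.integral_comp_sub_left (a := -1) (b := 1)
    (fun z => hkP t z * hkF f (x - z)) x
  simp only [sub_sub_cancel] at s3
  rw [s3]
  have hper : Function.Periodic (fun z => hkP t z * hkF f (x - z)) 2 := by
    intro z
    have a := hkP_periodic t z
    have b := hkF_periodic f (x - (z + 2))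
    have e : x - (z + 2) + 2 = x - z := by ring
    rw [e] at b
    simp only [a, b]
  have := hper.intervalIntegral_add_eq (x - 1) (-1)
  have e1 : x - 1 + 2 = x - -1 := by ring
  have e2 : (-1 : ℝ) + 2 = 1 := by norm_num
  rw [e1, e2] at this
  exact this

theorem semigroup_preserves_Holder (α : ℝ) (hα : α ∈ Set.Ioc (0 : ℝ) 1) :
    ∃ C : ℝ, ∀ (f : ℝ → ℝ) (M : ℝ),
      f 0 = 0 → f 1 = 0 →
      (∀ x ∈ Set.Icc (0 : ℝ) 1, ∀ y ∈ Set.Icc (0 : ℝ) 1,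
        |f x - f y| ≤ M * |x - y| ^ α) →
      ∀ t : ℝ, 0 < t → ∀ x ∈ Set.Icc (0 : ℝ) 1, ∀ x' ∈ Set.Icc (0 : ℝ) 1,
        |(∫ y in (0 : ℝ)..1, G t x y * f y) - (∫ y in (0 : ℝ)..1, G t x' y * f y)|
          ≤ C * M * |x - x'| ^ α := by
  refine ⟨2, ?_⟩
  intro f M h0 h1 hf t ht x _ x' _
  have hM : 0 ≤ M := by
    have := hf 0 (by simp) 1 (by simp)
    simpa [h0, h1] using this
  have hF := hkF_continuous f h0 h1 M α hα.1 hM hf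
  have hP := hkP_continuous t ht
  rw [hk_repr f h0 h1 hF t x ht, hk_repr f h0 h1 hF t x' ht,
    ← intervalIntegral.integral_sub (Continuous.intervalIntegrable (by fun_prop) _ _)
      (Continuous.intervalIntegrable (by fun_prop) _ _)]
  have hb := intervalIntegral.norm_integral_le_of_norm_le (a := -1) (b := 1) (μ := volume)
    (f := fun z => hkP t z * hkF f (x - z) - hkP t z * hkF f (x' - z))
    (g := fun z => hkP t z * (2 * M * |x - x'| ^ α)) (by norm_num)
    (by
      filter_upwards with z _
      rw [← mul_sub, norm_mul, Real.norm_eq_abs, Real.norm_eq_abs,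
        abs_of_nonneg (hkP_nonneg t z ht)]
      apply mul_le_mul_of_nonneg_left _ (hkP_nonneg t z ht)
      have := hkF_holder f h0 h1 M α hα.1 hM hf (x - z) (x' - z)
      simpa using this)
    (Continuous.intervalIntegrable (by fun_prop) _ _)
  rw [intervalIntegral.integral_mul_const, hkP_integral t ht, one_mul] at hb
  exact hb
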